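/- arXiv:1507.06684 — 7 statements merged into one kernel-verified Lean document; each statement's English description precedes it below -/
import Mathlib

section
/- Main Theorem (set-theoretic closing-off argument): Let X be a set, κ an infinite cardinal, and c : [X]^{≤κ} → [X]^{≤2^κ} a function that is an operator (i.e., for A ⊆ B in [X]^{≤κ}, A ⊆ c(A) ⊆ c(B)). For each x ∈ X let {V(x,α) : α < κ} be a collection of subsets of X, and let h : 𝒫(X) → 𝒫(X) be an expansive function (i.e., S ⊆ h(S) for every S ⊆ X). Assume the cover-separation condition: whenever H is a nonempty subset of X with |H| ≤ 2^κ such that c(A) ⊆ H for all A ∈ [H]^{≤κ}, then for every q ∉ H there exist A ∈ [H]^{≤κ} and a function f : A → κ such that |H \ h(⋃_{x∈A} V(x,f(x)))| < 2^κ and q ∉ h(⋃_{x∈A} V(x,f(x))). Then |X| ≤ 2^κ. -/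
open Cardinal Set

universe u

theorem closure_aux {X : Type u} (κ : Cardinal.{u}) (hκ : ℵ₀ ≤ κ)
    (ι : Type u) (hι : #ι = κ) (x0 : X) (G : Set X → Set X)
    (hG : ∀ A : Set X, #↥A ≤ κ → #↥(G A) ≤ 2 ^ κ) :
    ∃ H : Set X, x0 ∈ H ∧ #↥H ≤ 2 ^ κ ∧ ∀ A : Set X, A ⊆ H → #↥A ≤ κ → G A ⊆ H := by
  classical
  have he : ∀ A : Set X, ∃ e : Set ι → X, #↥A ≤ κ → G A ⊆ range e := by
    intro A
    by_cases hA : #↥A ≤ κ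
    · have h1 : #↥(G A) ≤ #(Set ι) := by rw [mk_set, hι]; exact hG A hA
      obtain ⟨j⟩ := h1
      refine ⟨Function.extend j (fun a => (a : X)) (fun _ => x0), fun _ x hx => ⟨j ⟨x, hx⟩, ?_⟩⟩
      rw [j.injective.extend_apply]
    · exact ⟨fun _ => x0, fun h => absurd h hA⟩
  choose e he using he
  let β : Option (Set ι × Set ι) → Type u := fun o => Option.elim o PEmpty (fun p => ↥p.1)
  let step : (Σ a, (β a → X)) → X := fun p => match p with
    | ⟨none, _⟩ => x0
    | ⟨some q, g⟩ => e (range g) q.2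
  let ev : WType β → X := WType.elim X step
  have h2 : ℵ₀ ≤ (2 : Cardinal.{u}) ^ κ := hκ.trans (cantor κ).le
  have hα : #(Option (Set ι × Set ι)) ≤ 2 ^ κ := by
    rw [mk_option, mk_prod, mk_set, hι]
    simp only [lift_id]
    rw [mul_eq_self h2]
    exact (add_one_eq h2).le
  have hβ : ∀ a, #(β a) ≤ κ := by
    rintro (_ | q)
    · simp [β]
    · exact (mk_set_le q.1).trans hι.le
  have hW : #(WType β) ≤ 2 ^ κ := by
    apply WType.cardinalMk_le_of_le'
    refine (sum_le_sum _ (fun _ => 2 ^ κ) fun a => ?_).trans ?_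
    · rw [lift_id]
      calc ((2 : Cardinal.{u}) ^ κ) ^ #(β a) ≤ (2 ^ κ) ^ κ :=
            power_le_power_left (aleph0_pos.trans_le h2).ne' (hβ a)
        _ = 2 ^ κ := by rw [← power_mul, mul_eq_self hκ]
    · rw [sum_const']
      exact (mul_le_mul_left hα _).trans (mul_eq_self h2).le
  refine ⟨range ev, ⟨WType.mk none PEmpty.elim, rfl⟩, mk_range_le.trans hW, ?_⟩
  intro A hAH hA x hx
  have h3 : #↥A ≤ #ι := hι ▸ hA
  obtain ⟨j⟩ := h3
  choose w hw using hAH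
  let E := Equiv.ofInjective j j.injective
  obtain ⟨p, hp⟩ := he A hA hx
  let g : β (some (range j, p)) → WType β := fun i => w (E.symm i).2
  have hg : range (fun i => ev (g i)) = A := by
    ext y
    constructor
    · rintro ⟨i, rfl⟩
      simp only [g]
      rw [hw]
      exact (E.symm i).2
    · intro hy
      refine ⟨E ⟨y, hy⟩, ?_⟩
      simp only [g]
      rw [hw]
      simp
  refine ⟨WType.mk (some (range j, p)) g, ?_⟩
  change e (range (fun i => ev (g i))) p = x
  rw [hg, hp]

/-- Main Theorem (set-theoretic closing-off argument). -/
theorem main_closing_off {X : Type u} (κ : Cardinal.{u}) (hκ : ℵ₀ ≤ κ)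
    (ι : Type u) (hι : #ι = κ)
    (c : Set X → Set X)
    (hc_card : ∀ A : Set X, #↥A ≤ κ → #↥(c A) ≤ 2 ^ κ)
    (hc_op : ∀ A B : Set X, #↥A ≤ κ → #↥B ≤ κ → A ⊆ B → A ⊆ c A ∧ c A ⊆ c B)
    (V : X → ι → Set X)
    (h : Set X → Set X) (hh : ∀ S : Set X, S ⊆ h S)
    (hCS : ∀ H : Set X, H.Nonempty → #↥H ≤ 2 ^ κ →
      (∀ A : Set X, A ⊆ H → #↥A ≤ κ → c A ⊆ H) →
      ∀ q ∉ H, ∃ A : Set X, A ⊆ H ∧ #↥A ≤ κ ∧ ∃ f : X → ι,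
        #↥(H \ h (⋃ x ∈ A, V x (f x))) < 2 ^ κ ∧ q ∉ h (⋃ x ∈ A, V x (f x))) :
    #X ≤ 2 ^ κ := by
  classical
  rcases isEmpty_or_nonempty X with hX | ⟨⟨x0⟩⟩
  · simp
  have h2 : ℵ₀ ≤ (2 : Cardinal.{u}) ^ κ := hκ.trans (cantor κ).le
  have hD : ∀ W : Set X, ∃ D : Set X, D ⊆ Wᶜ ∧ #↥D ≤ 2 ^ κ ∧ (#↥D < 2 ^ κ → D = Wᶜ) := by
    intro W
    rcases lt_or_ge (#↥(Wᶜ)) (2 ^ κ) with hlt | hge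
    · exact ⟨Wᶜ, Subset.rfl, hlt.le, fun _ => rfl⟩
    · obtain ⟨D, hD, hDc⟩ := le_mk_iff_exists_subset.1 hge
      exact ⟨D, hD, hDc.le, fun hlt => absurd hDc hlt.ne⟩
  choose D hDs hDc hDe using hD
  let G : Set X → Set X := fun A =>
    c A ∪ ⋃ f : ↥A → ι, D (h (⋃ x : ↥A, V x (f x)))
  have hG : ∀ A : Set X, #↥A ≤ κ → #↥(G A) ≤ 2 ^ κ := by
    intro A hA
    refine (mk_union_le _ _).trans (add_le_of_le h2 (hc_card A hA) ?_)
    refine (mk_iUnion_le _).trans ?_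
    refine (mul_le_mul' (b := 2 ^ κ) (d := 2 ^ κ) ?_ ?_).trans (mul_eq_self h2).le
    · rw [← power_def, hι]
      calc κ ^ #↥A ≤ κ ^ κ := power_le_power_left (aleph0_pos.trans_le hκ).ne' hA
        _ = 2 ^ κ := power_self_eq hκ
    · exact ciSup_le' fun f => hDc _
  obtain ⟨H, hx0, hHc, hH⟩ := closure_aux κ hκ ι hι x0 G hG
  suffices hu : H = Set.univ by
    rw [← mk_univ, ← hu]; exact hHc
  rw [eq_univ_iff_forall]
  by_contra! hq
  obtain ⟨q, hq⟩ := hq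
  obtain ⟨A, hAH, hA, f, hlt, hqn⟩ := hCS H ⟨x0, hx0⟩ hHc
    (fun A hAH hA => subset_union_left.trans (hH A hAH hA)) q hq
  rw [biUnion_eq_iUnion] at hlt hqn
  have hDH : D (h (⋃ x : ↥A, V x (f x))) ⊆ H := by
    refine Subset.trans ?_ (hH A hAH hA)
    refine Subset.trans ?_ subset_union_right
    exact subset_iUnion (fun f : ↥A → ι => D (h (⋃ x : ↥A, V x (f x)))) (fun x => f x)
  have hlt' := (mk_le_mk_of_subset (show D (h (⋃ x : ↥A, V x (f x))) ⊆
    H \ h (⋃ x : ↥A, V x (f x)) from fun y hy => ⟨hDH hy, hDs _ hy⟩)).trans_lt hlt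
  have := hDe _ hlt'
  exact hq (hDH (this ▸ hqn))
end

section
/- For any Hausdorff space X: ψ_c(X) ≤ ψ(X) · skL(X, ψ(X)⁺). -/
open Cardinal Set

universe u

/-- Skew-λ Lindelöf degree of `A` in `X`. -/
noncomputable def skLrel (X : Type u) [TopologicalSpace X] (A : Set X) (lam : Cardinal.{u}) :
    Cardinal.{u} :=
  sInf {κ : Cardinal.{u} | ℵ₀ ≤ κ ∧
    ∀ 𝒰 : Set (Set X), (∀ U ∈ 𝒰, IsOpen U) → A ⊆ ⋃₀ 𝒰 →
      ∃ 𝒱 ⊆ 𝒰, #↥𝒱 ≤ κ ∧ #↥(A \ ⋃₀ 𝒱) < lam}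

/-- Skew-λ Lindelöf degree of `X`. -/
noncomputable def skL (X : Type u) [TopologicalSpace X] (lam : Cardinal.{u}) : Cardinal.{u} :=
  skLrel X Set.univ lam

/-- Lindelöf degree of `X`. -/
noncomputable def Ldeg (X : Type u) [TopologicalSpace X] : Cardinal.{u} :=
  sInf {κ : Cardinal.{u} | ℵ₀ ≤ κ ∧
    ∀ 𝒰 : Set (Set X), (∀ U ∈ 𝒰, IsOpen U) → ⋃₀ 𝒰 = Set.univ →
      ∃ 𝒱 ⊆ 𝒰, #↥𝒱 ≤ κ ∧ ⋃₀ 𝒱 = Set.univ}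

/-- Pseudocharacter of `X`. -/
noncomputable def psi (X : Type u) [TopologicalSpace X] : Cardinal.{u} :=
  sInf {κ : Cardinal.{u} | ℵ₀ ≤ κ ∧
    ∀ x : X, ∃ 𝒱 : Set (Set X), (∀ V ∈ 𝒱, IsOpen V) ∧ #↥𝒱 ≤ κ ∧ ⋂₀ 𝒱 = {x}}

/-- Closed pseudocharacter of `X`. -/
noncomputable def psic (X : Type u) [TopologicalSpace X] : Cardinal.{u} :=
  sInf {κ : Cardinal.{u} | ℵ₀ ≤ κ ∧
    ∀ x : X, ∃ 𝒱 : Set (Set X), (∀ V ∈ 𝒱, IsOpen V ∧ x ∈ V) ∧ #↥𝒱 ≤ κ ∧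
      (⋂ V ∈ 𝒱, closure V) = {x}}

/-- Tightness of `X`. -/
noncomputable def tight (X : Type u) [TopologicalSpace X] : Cardinal.{u} :=
  sInf {κ : Cardinal.{u} | ℵ₀ ≤ κ ∧
    ∀ (A : Set X) (x : X), x ∈ closure A → ∃ B ⊆ A, #↥B ≤ κ ∧ x ∈ closure B}

/-- Character of `X`. -/
noncomputable def charDeg (X : Type u) [TopologicalSpace X] : Cardinal.{u} :=
  sInf {κ : Cardinal.{u} | ℵ₀ ≤ κ ∧
    ∀ x : X, ∃ ℬ : Set (Set X), (∀ B ∈ ℬ, IsOpen B ∧ x ∈ B) ∧ #↥ℬ ≤ κ ∧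
      ∀ U : Set X, IsOpen U → x ∈ U → ∃ B ∈ ℬ, B ⊆ U}

/-- Density of `X`. -/
noncomputable def dens (X : Type u) [TopologicalSpace X] : Cardinal.{u} :=
  sInf {κ : Cardinal.{u} | ℵ₀ ≤ κ ∧ ∃ D : Set X, Dense D ∧ #↥D ≤ κ}

/-- θ-network weight of `X`. -/
noncomputable def nwTheta (X : Type u) [TopologicalSpace X] : Cardinal.{u} :=
  sInf {κ : Cardinal.{u} | ℵ₀ ≤ κ ∧
    ∃ 𝒩 : Set (Set X), 𝒩.Nonempty ∧ #↥𝒩 ≤ κ ∧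
      ∀ (x : X) (U : Set X), IsOpen U → x ∈ U → ∃ N ∈ 𝒩, x ∈ N ∧ N ⊆ closure U}

/-- Skew-λ almost Lindelöf degree of `A` in `X`. -/
noncomputable def saLrel (X : Type u) [TopologicalSpace X] (A : Set X) (lam : Cardinal.{u}) :
    Cardinal.{u} :=
  sInf {κ : Cardinal.{u} | ℵ₀ ≤ κ ∧
    ∀ 𝒰 : Set (Set X), (∀ U ∈ 𝒰, IsOpen U) → A ⊆ ⋃₀ 𝒰 →
      ∃ 𝒱 ⊆ 𝒰, #↥𝒱 ≤ κ ∧ #↥(A \ ⋃ V ∈ 𝒱, closure V) < lam}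

/-- Skew-λ almost Lindelöf degree of `X`. -/
noncomputable def saL (X : Type u) [TopologicalSpace X] (lam : Cardinal.{u}) : Cardinal.{u} :=
  saLrel X Set.univ lam

/-- Skew-λ almost Lindelöf degree of `X` with respect to closed sets. -/
noncomputable def saLc (X : Type u) [TopologicalSpace X] (lam : Cardinal.{u}) : Cardinal.{u} :=
  sSup {c : Cardinal.{u} | ∃ A : Set X, IsClosed A ∧ c = saLrel X A lam}

/-- κ-closure of a set. -/
def clk {X : Type u} [TopologicalSpace X] (κ : Cardinal.{u}) (A : Set X) : Set X :=
  ⋃ B ∈ {B : Set X | B ⊆ A ∧ #↥B ≤ κ}, closure B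

/-- Skew-λ almost Lindelöf degree of `X` with respect to κ-closed sets. -/
noncomputable def saLk (X : Type u) [TopologicalSpace X] (κ lam : Cardinal.{u}) : Cardinal.{u} :=
  sSup {c : Cardinal.{u} | ∃ A : Set X, clk κ A = A ∧ c = saLrel X A lam}

/-- Skew-λ weak Lindelöf degree of `A` in `X`. -/
noncomputable def swLrel (X : Type u) [TopologicalSpace X] (A : Set X) (lam : Cardinal.{u}) :
    Cardinal.{u} :=
  sInf {κ : Cardinal.{u} | ℵ₀ ≤ κ ∧
    ∀ 𝒰 : Set (Set X), (∀ U ∈ 𝒰, IsOpen U) → A ⊆ ⋃₀ 𝒰 →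
      ∃ 𝒱 ⊆ 𝒰, #↥𝒱 ≤ κ ∧ #↥(A \ closure (⋃₀ 𝒱)) < lam}

/-- Skew-λ weak Lindelöf degree of `X`. -/
noncomputable def swL (X : Type u) [TopologicalSpace X] (lam : Cardinal.{u}) : Cardinal.{u} :=
  swLrel X Set.univ lam

/-- Skew-λ weak Lindelöf degree of `X` with respect to closed sets. -/
noncomputable def swLc (X : Type u) [TopologicalSpace X] (lam : Cardinal.{u}) : Cardinal.{u} :=
  sSup {c : Cardinal.{u} | ∃ A : Set X, IsClosed A ∧ c = swLrel X A lam}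

lemma psi_mem_aux (X : Type u) [TopologicalSpace X] [T2Space X] :
    ℵ₀ ≤ psi X ∧ ∀ x : X, ∃ 𝒱 : Set (Set X), (∀ V ∈ 𝒱, IsOpen V) ∧ #↥𝒱 ≤ psi X ∧
      ⋂₀ 𝒱 = {x} := by
  apply csInf_mem (s := {κ : Cardinal.{u} | ℵ₀ ≤ κ ∧
    ∀ x : X, ∃ 𝒱 : Set (Set X), (∀ V ∈ 𝒱, IsOpen V) ∧ #↥𝒱 ≤ κ ∧ ⋂₀ 𝒱 = {x}})
  refine ⟨max ℵ₀ #(Set X), le_max_left _ _, fun x => ?_⟩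
  refine ⟨{V | IsOpen V ∧ x ∈ V}, fun V hV => hV.1, (mk_set_le _).trans (le_max_right _ _), ?_⟩
  ext y
  simp only [mem_sInter, mem_setOf_eq, mem_singleton_iff]
  constructor
  · intro h
    by_contra hne
    exact h {y}ᶜ ⟨isOpen_compl_singleton, fun hx => hne hx.symm⟩ rfl
  · rintro rfl V hV
    exact hV.2

lemma skL_mem_aux (X : Type u) [TopologicalSpace X] (lam : Cardinal.{u}) (h0 : 0 < lam) :
    ℵ₀ ≤ skL X lam ∧ ∀ 𝒰 : Set (Set X), (∀ U ∈ 𝒰, IsOpen U) → Set.univ ⊆ ⋃₀ 𝒰 →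
      ∃ 𝒱 ⊆ 𝒰, #↥𝒱 ≤ skL X lam ∧ #↥(Set.univ \ ⋃₀ 𝒱) < lam := by
  apply csInf_mem (s := {κ : Cardinal.{u} | ℵ₀ ≤ κ ∧
    ∀ 𝒰 : Set (Set X), (∀ U ∈ 𝒰, IsOpen U) → Set.univ ⊆ ⋃₀ 𝒰 →
      ∃ 𝒱 ⊆ 𝒰, #↥𝒱 ≤ κ ∧ #↥(Set.univ \ ⋃₀ 𝒱) < lam})
  refine ⟨max ℵ₀ #(Set X), le_max_left _ _, fun 𝒰 _ hc => ?_⟩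
  refine ⟨𝒰, Subset.rfl, (mk_set_le _).trans (le_max_right _ _), ?_⟩
  rw [diff_eq_empty.2 hc]
  simpa using h0

/-- Proposition 3.2(e): ψ_c(X) ≤ ψ(X) · skL(X, ψ(X)⁺). -/
theorem psic_le_psi_mul_skL {X : Type u} [TopologicalSpace X] [T2Space X] :
    psic X ≤ psi X * skL X (Order.succ (psi X)) := by
  obtain ⟨hψ, hpsi⟩ := psi_mem_aux X
  obtain ⟨hs, hskL⟩ := skL_mem_aux X (Order.succ (psi X))
    (lt_of_le_of_lt (zero_le) (Order.lt_succ (psi X)))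
  set p := psi X with hp
  set s := skL X (Order.succ p) with hsdef
  have hs0 : s ≠ 0 := (aleph0_pos.trans_le hs).ne'
  have hp0 : p ≠ 0 := (aleph0_pos.trans_le hψ).ne'
  have hps : ℵ₀ ≤ p * s := hψ.trans (le_mul_right hs0)
  refine csInf_le' ⟨hps, fun x => ?_⟩
  obtain ⟨𝒱, hVo, hVc, hVx⟩ := hpsi x
  have hxV : ∀ V ∈ 𝒱, x ∈ V := by
    have : x ∈ ⋂₀ 𝒱 := by rw [hVx]; rfl
    exact this
  have hw : ∀ U : Set X, ∃ W : Set X, (IsOpen W ∧ x ∈ W) ∧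
      ((∃ W', IsOpen W' ∧ x ∈ W' ∧ Disjoint U W') → Disjoint U W) := by
    intro U
    by_cases h : ∃ W', IsOpen W' ∧ x ∈ W' ∧ Disjoint U W'
    · obtain ⟨W, h1, h2, h3⟩ := h
      exact ⟨W, ⟨h1, h2⟩, fun _ => h3⟩
    · exact ⟨univ, ⟨isOpen_univ, mem_univ _⟩, fun h' => absurd h' h⟩
  choose w hw1 hw2 using hw
  have hz : ∀ z : X, ∃ U : Set X, IsOpen U ∧ (z ≠ x → z ∈ U ∧
      ∃ W', IsOpen W' ∧ x ∈ W' ∧ Disjoint U W') := by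
    intro z
    by_cases h : z = x
    · exact ⟨univ, isOpen_univ, fun h' => absurd h h'⟩
    · obtain ⟨U, W, hU, hW, hzU, hxW, hd⟩ := t2_separation h
      exact ⟨U, hU, fun _ => ⟨hzU, W, hW, hxW, hd⟩⟩
  choose g hg1 hg2 using hz
  have key : ∀ U : Set X, IsOpen U → (∃ W', IsOpen W' ∧ x ∈ W' ∧ Disjoint U W') →
      ∀ z ∈ U, z ∉ closure (w U) := by
    intro U hU h z hzU hc
    exact disjoint_left.1 ((hw2 U h).closure_right hU) hzU hc
  have hcov : ∀ V : 𝒱, ∃ 𝒰 : Set (Set X), 𝒰 ⊆ insert V.1 (g '' (V.1)ᶜ) ∧ #↥𝒰 ≤ s ∧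
      #↥(Set.univ \ ⋃₀ 𝒰) ≤ p := by
    intro V
    obtain ⟨𝒰, h1, h2, h3⟩ := hskL (insert V.1 (g '' (V.1)ᶜ)) (by
      rintro U (rfl | ⟨z, _, rfl⟩)
      · exact hVo _ V.2
      · exact hg1 z) (by
      intro z _
      by_cases hzV : z ∈ V.1
      · exact ⟨V.1, mem_insert _ _, hzV⟩
      · exact ⟨g z, mem_insert_of_mem _ ⟨z, hzV, rfl⟩,
          (hg2 z (fun h => hzV (h ▸ hxV _ V.2))).1⟩)
    exact ⟨𝒰, h1, h2, Order.lt_succ_iff.1 h3⟩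
  choose C hC1 hC2 hC3 using hcov
  refine ⟨⋃ V : 𝒱, (w '' C V ∪ (fun z => w (g z)) '' (Set.univ \ ⋃₀ C V)), ?_, ?_, ?_⟩
  · intro W hW
    obtain ⟨V, hV⟩ := mem_iUnion.1 hW
    rcases hV with ⟨U, _, rfl⟩ | ⟨z, _, rfl⟩
    · exact hw1 U
    · exact hw1 _
  · have hb : ∀ V : 𝒱, #↥(w '' C V ∪ (fun z => w (g z)) '' (Set.univ \ ⋃₀ C V)) ≤ p * s := by
      intro V
      refine (mk_union_le _ _).trans (add_le_of_le hps ?_ ?_)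
      · exact mk_image_le.trans ((hC2 V).trans (le_mul_left hp0))
      · exact mk_image_le.trans ((hC3 V).trans (le_mul_right hs0))
    refine (mk_iUnion_le_sum_mk).trans ((sum_le_sum _ _ hb).trans ?_)
    rw [sum_const']
    calc #↥𝒱 * (p * s) ≤ (p * s) * (p * s) :=
          mul_le_mul' (hVc.trans (le_mul_right hs0)) le_rfl
      _ = p * s := mul_eq_self hps
  · ext z
    rw [mem_singleton_iff]
    constructor
    · intro h
      by_contra hne
      have h' : z ∉ ⋂₀ 𝒱 := by rw [hVx]; exact hne
      rw [mem_sInter] at h'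
      push Not at h'
      obtain ⟨V, hV, hzV⟩ := h'
      simp only [mem_iInter] at h
      by_cases hzU : z ∈ ⋃₀ C ⟨V, hV⟩
      · obtain ⟨U, hU, hzU⟩ := hzU
        have hm := h (w U) (mem_iUnion.2 ⟨⟨V, hV⟩, Or.inl ⟨U, hU, rfl⟩⟩)
        rcases hC1 _ hU with rfl | ⟨y, hy, rfl⟩
        · exact hzV hzU
        · have hyx : y ≠ x := fun e => hy (e ▸ hxV _ hV)
          exact key _ (hg1 y) (hg2 y hyx).2 z hzU hm
      · have hm := h (w (g z)) (mem_iUnion.2 ⟨⟨V, hV⟩, Or.inr ⟨z, ⟨mem_univ _, hzU⟩, rfl⟩⟩)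
        exact key _ (hg1 z) (hg2 z hne).2 z (hg2 z hne).1 hm
    · rintro rfl
      refine mem_iInter₂.2 fun W hW => ?_
      obtain ⟨V, hV⟩ := mem_iUnion.1 hW
      rcases hV with ⟨U, _, rfl⟩ | ⟨y, _, rfl⟩
      · exact subset_closure (hw1 U).2
      · exact subset_closure (hw1 _).2
end

section
/- For any Hausdorff space X: |X| ≤ 2^{skL(X, 2^{ψ(X)·t(X)}) · ψ(X) · t(X)}. -/
open Cardinal Set

universe u

theorem skl_exists_range {α K : Type u} {S : Set α} (hS : S.Nonempty) (h : #S ≤ #K) :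
    ∃ f : K → α, Set.range f = S := by
  haveI : Nonempty S := hS.to_subtype
  obtain ⟨e⟩ := h
  refine ⟨fun k => (Function.invFun e k : S), ?_⟩
  ext x
  constructor
  · rintro ⟨k, rfl⟩
    exact (Function.invFun e k).2
  · intro hx
    exact ⟨e ⟨x, hx⟩, by simp [Function.leftInverse_invFun e.injective ⟨x, hx⟩]⟩

theorem skl_insert_le {α K : Type u} [Infinite K] {S : Set α} (a : α) (h : #S ≤ #K) :
    #(insert a S : Set α) ≤ #K := by
  have hK : ℵ₀ ≤ #K := Cardinal.aleph0_le_mk K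
  refine (Cardinal.mk_insert_le).trans ?_
  exact Cardinal.add_le_of_le hK h (Cardinal.one_le_aleph0.trans hK)

theorem skl_iUnion_le {α ι : Type u} {c : Cardinal.{u}} (hc : ℵ₀ ≤ c) (hι : #ι ≤ c)
    (A : ι → Set α) (hA : ∀ i, #(A i) ≤ c) : #(⋃ i, A i) ≤ c := by
  refine (Cardinal.mk_iUnion_le_sum_mk).trans ((Cardinal.sum_le_sum _ (fun _ => c) hA).trans ?_)
  simp only [Cardinal.sum_const', ]
  exact Cardinal.mul_le_of_le hc hι le_rfl

/-- Closing off. -/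
theorem skl_closing {X K : Type u} [Infinite K] (x0 : X) (op : (K → X) → Set X)
    (hop : ∀ b, #(op b) ≤ 2 ^ #K) :
    ∃ H : Set X, x0 ∈ H ∧ #H ≤ 2 ^ #K ∧ ∀ b : K → X, (∀ k, b k ∈ H) → op b ⊆ H := by
  classical
  have hK : ℵ₀ ≤ #K := Cardinal.aleph0_le_mk K
  have h2 : ℵ₀ ≤ (2 : Cardinal.{u}) ^ #K := hK.trans (Cardinal.cantor _).le
  have hT : ∀ b : K → X, ∃ e : Set K → X, op b ⊆ Set.range e := by
    intro b
    obtain ⟨e, he⟩ := skl_exists_range (K := Set K) (Set.insert_nonempty x0 (op b))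
      (by
        haveI : Infinite (Set K) := by infer_instance
        exact skl_insert_le _ (by simpa using hop b))
    exact ⟨e, he ▸ Set.subset_insert _ _⟩
  choose e he using hT
  let β : Option (Set K) → Type u := fun a => match a with
    | none => PEmpty
    | some _ => K
  let ev : WType β → X := fun w => WType.elim X (fun p => match p with
    | ⟨none, _⟩ => x0
    | ⟨some t, f⟩ => e f t) w
  refine ⟨Set.range ev, ⟨WType.mk none (fun z => PEmpty.elim z), rfl⟩, ?_, ?_⟩
  · refine Cardinal.mk_range_le.trans (WType.cardinalMk_le_of_le' ?_)
    refine (Cardinal.sum_le_sum _ (fun _ => 2 ^ #K) ?_).trans ?_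
    · rintro (_ | t)
      · simpa [β] using Cardinal.one_le_aleph0.trans h2
      · rw [Cardinal.lift_id]
        show ((2 : Cardinal.{u}) ^ #K) ^ #K ≤ _
        rw [← Cardinal.power_mul, Cardinal.mul_eq_self hK]
    · simp only [Cardinal.sum_const']
      refine Cardinal.mul_le_of_le h2 ?_ le_rfl
      rw [Cardinal.mk_option, Cardinal.mk_set]
      exact Cardinal.add_le_of_le h2 le_rfl (Cardinal.one_le_aleph0.trans h2)
  · intro b hb y hy
    choose w hw using hb
    obtain ⟨t, ht⟩ := he b hy
    refine ⟨WType.mk (some t) w, ?_⟩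
    have : (fun k => ev (w k)) = b := funext hw
    rw [← ht, ← this]
    rfl

theorem skl_closed_pseudo {X K : Type u} [TopologicalSpace X] [T2Space X] [Infinite K]
    (lam : Cardinal.{u}) (hlam : lam ≤ 2 ^ #K)
    (hL : ∀ 𝒰 : Set (Set X), (∀ U ∈ 𝒰, IsOpen U) → Set.univ ⊆ ⋃₀ 𝒰 →
      ∃ 𝒱 ⊆ 𝒰, #↥𝒱 ≤ #K ∧ #↥(Set.univ \ ⋃₀ 𝒱) < lam)
    (x : X) (U : K → Set X) (hU : ∀ k, IsOpen (U k)) (hUx : ⋂ k, U k = {x}) :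
    ∃ N : K × K → Set X, (∀ i, IsOpen (N i) ∧ x ∈ N i) ∧ #(⋂ i, closure (N i) : Set X) ≤ 2 ^ #K := by
  classical
  have hK : ℵ₀ ≤ #K := Cardinal.aleph0_le_mk K
  have h2 : ℵ₀ ≤ (2 : Cardinal.{u}) ^ #K := hK.trans (Cardinal.cantor _).le
  have hxU : ∀ k, x ∈ U k := by
    have : x ∈ ⋂ k, U k := by rw [hUx]; rfl
    simpa using this
  have key : ∀ k, ∃ V : K → Set X, (∀ j, IsOpen (V j) ∧ (V j = U k ∨ x ∉ closure (V j))) ∧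
      #↥(Set.univ \ ⋃ j, V j) < lam := by
    intro k
    obtain ⟨𝒱, h𝒱, hc, hl⟩ := hL (insert (U k) {W | IsOpen W ∧ x ∉ closure W})
      (by
        rintro W (rfl | hW)
        · exact hU k
        · exact hW.1)
      (by
        intro y _
        by_cases hy : y = x
        · exact ⟨U k, Set.mem_insert _ _, hy ▸ hxU k⟩
        · obtain ⟨A, B, hA, hB, hyA, hxB, hd⟩ := t2_separation hy
          refine ⟨A, Or.inr ⟨hA, fun hx => ?_⟩, hyA⟩
          exact (hd.symm.closure_right hB).le_bot ⟨hxB, hx⟩)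
    obtain ⟨V, hV⟩ := skl_exists_range (K := K) (Set.insert_nonempty (U k) 𝒱) (skl_insert_le _ hc)
    refine ⟨V, fun j => ?_, ?_⟩
    · have : V j ∈ insert (U k) 𝒱 := hV ▸ Set.mem_range_self j
      rcases this with h | h
      · exact ⟨h ▸ hU k, Or.inl h⟩
      · rcases h𝒱 h with h | h
        · exact ⟨h ▸ hU k, Or.inl h⟩
        · exact ⟨h.1, Or.inr h.2⟩
    · refine (Cardinal.mk_le_mk_of_subset ?_).trans_lt hl
      refine Set.diff_subset_diff_right ?_
      rw [← Set.sUnion_range, hV]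
      exact Set.sUnion_subset_sUnion (Set.subset_insert _ _)
  choose V hV hVl using key
  refine ⟨fun i => if x ∈ closure (V i.1 i.2) then Set.univ else (closure (V i.1 i.2))ᶜ, ?_, ?_⟩
  · intro i
    dsimp only
    split_ifs with h
    · exact ⟨isOpen_univ, trivial⟩
    · exact ⟨isClosed_closure.isOpen_compl, h⟩
  · have hsub : (⋂ i : K × K, closure (if x ∈ closure (V i.1 i.2) then Set.univ
        else (closure (V i.1 i.2))ᶜ)) ⊆ insert x (⋃ k, (Set.univ \ ⋃ j, V k j)) := by
      intro y hy
      by_cases hyx : y = x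
      · exact Or.inl hyx
      right
      have : ∃ k, y ∉ U k := by
        by_contra hcon
        push Not at hcon
        have : y ∈ ⋂ k, U k := by simpa using hcon
        rw [hUx] at this
        exact hyx this
      obtain ⟨k, hk⟩ := this
      refine Set.mem_iUnion.2 ⟨k, trivial, fun hyV => ?_⟩
      obtain ⟨j, hj⟩ := Set.mem_iUnion.1 hyV
      rcases (hV k j).2 with h | h
      · exact hk (h ▸ hj)
      · have h3 := Set.mem_iInter.1 hy (k, j)
        rw [if_neg h] at h3
        obtain ⟨z, hz1, hz2⟩ := mem_closure_iff.1 h3 (V k j) (hV k j).1 hj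
        exact hz2 (subset_closure hz1)
    refine (Cardinal.mk_le_mk_of_subset hsub).trans ?_
    rw [← Cardinal.mk_set] at h2 hlam ⊢
    refine skl_insert_le _ ?_
    refine skl_iUnion_le h2 ?_ _ (fun k => (hVl k).le.trans hlam)
    rw [Cardinal.mk_set]
    exact (Cardinal.cantor _).le

theorem skl_closure_le {X K : Type u} [TopologicalSpace X] [Infinite K]
    (N : X → K × K → Set X) (hN : ∀ x i, IsOpen (N x i) ∧ x ∈ N x i)
    (hc : ∀ x, #(⋂ i, closure (N x i) : Set X) ≤ 2 ^ #K) (b : K → X) :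
    #(closure (Set.range b)) ≤ 2 ^ #K := by
  have hK : ℵ₀ ≤ #K := Cardinal.aleph0_le_mk K
  have h2 : ℵ₀ ≤ (2 : Cardinal.{u}) ^ #K := hK.trans (Cardinal.cantor _).le
  let F : (K × K → Set K) → Set X := fun c => ⋂ i, closure (b '' c i)
  let C : Set (K × K → Set K) := {c | #(F c) ≤ 2 ^ #K}
  have hsub : closure (Set.range b) ⊆ ⋃ c : C, F c.1 := by
    intro x hx
    have hsubs : F (fun i => {j | b j ∈ N x i}) ⊆ ⋂ i, closure (N x i) := by
      refine Set.iInter_mono fun i => closure_mono ?_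
      rintro _ ⟨j, hj, rfl⟩
      exact hj
    refine Set.mem_iUnion.2 ⟨⟨fun i => {j | b j ∈ N x i},
      (Cardinal.mk_le_mk_of_subset hsubs).trans (hc x)⟩, ?_⟩
    refine Set.mem_iInter.2 fun i => ?_
    rw [mem_closure_iff]
    intro O hO hxO
    obtain ⟨z, ⟨hz1, hz2⟩, ⟨j, rfl⟩⟩ := mem_closure_iff.1 hx (O ∩ N x i) (hO.inter (hN x i).1)
      ⟨hxO, (hN x i).2⟩
    exact ⟨b j, hz1, ⟨j, hz2, rfl⟩⟩
  refine (Cardinal.mk_le_mk_of_subset hsub).trans (skl_iUnion_le h2 ?_ _ (fun c => c.2))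
  refine (Cardinal.mk_set_le C).trans ?_
  rw [← Cardinal.power_def, Cardinal.mk_set, Cardinal.mk_prod, Cardinal.lift_id,
    Cardinal.mul_eq_self hK, ← Cardinal.power_mul, Cardinal.mul_eq_self hK]

theorem skl_main {X K : Type u} [TopologicalSpace X] [T2Space X] [Infinite K]
    (lam : Cardinal.{u}) (hlam : lam ≤ 2 ^ #K)
    (hL : ∀ 𝒰 : Set (Set X), (∀ U ∈ 𝒰, IsOpen U) → Set.univ ⊆ ⋃₀ 𝒰 →
      ∃ 𝒱 ⊆ 𝒰, #↥𝒱 ≤ #K ∧ #↥(Set.univ \ ⋃₀ 𝒱) < lam)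
    (hpsi : ∀ x : X, ∃ U : K → Set X, (∀ k, IsOpen (U k)) ∧ ⋂ k, U k = {x})
    (ht : ∀ (A : Set X) (x : X), x ∈ closure A → ∃ B ⊆ A, #↥B ≤ #K ∧ x ∈ closure B) :
    #X ≤ 2 ^ #K := by
  classical
  have hK : ℵ₀ ≤ #K := Cardinal.aleph0_le_mk K
  have h2 : ℵ₀ ≤ (2 : Cardinal.{u}) ^ #K := hK.trans (Cardinal.cantor _).le
  rcases isEmpty_or_nonempty X with hX | ⟨⟨x0⟩⟩
  · simp
  choose U hU hUx using hpsi
  choose N hN hNc using fun x => skl_closed_pseudo lam hlam hL x (U x) (hU x) (hUx x)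
  have hg : ∀ S : Set X, ∃ G ⊆ S, #G ≤ lam ∧ (#G < lam → G = S) := by
    intro S
    by_cases h : lam ≤ #S
    · obtain ⟨G, hG, hGc⟩ := Cardinal.le_mk_iff_exists_subset.1 h
      exact ⟨G, hG, hGc.le, fun h => absurd hGc h.ne⟩
    · exact ⟨S, subset_rfl, (not_le.1 h).le, fun _ => rfl⟩
  choose g hgs hgc hge using hg
  obtain ⟨H, hx0, hHc, hH⟩ := skl_closing (K := K) x0
    (fun b => closure (Set.range b) ∪ ⋃ f : K → K, g (Set.univ \ ⋃ k, U (b k) (f k)))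
    (by
      intro b
      refine (Cardinal.mk_union_le _ _).trans (Cardinal.add_le_of_le h2
        (skl_closure_le N hN hNc b) (skl_iUnion_le h2 ?_ _ fun f => (hgc _).trans hlam))
      rw [← Cardinal.power_def, Cardinal.power_self_eq hK])
  have hclosed : IsClosed H := by
    refine isClosed_of_closure_subset fun x hx => ?_
    obtain ⟨B, hB, hBc, hxB⟩ := ht H x hx
    obtain ⟨b, rfl⟩ := skl_exists_range (closure_nonempty_iff.1 ⟨x, hxB⟩) hBc
    exact hH b (fun k => hB (Set.mem_range_self k)) (Or.inl hxB)
  have hall : ∀ p, p ∈ H := by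
    by_contra hcon
    push Not at hcon
    obtain ⟨p, hp⟩ := hcon
    have hf : ∀ x, ∃ k, x ∈ H → p ∉ U x k := by
      intro x
      by_contra hcon
      push Not at hcon
      have hxH := (hcon (Classical.arbitrary K)).1
      have : p ∈ ⋂ k, U x k := Set.mem_iInter.2 fun k => (hcon k).2
      rw [hUx] at this
      exact hp (this ▸ hxH)
    choose f hf using hf
    have hxU : ∀ x k, x ∈ U x k := by
      intro x
      have : x ∈ ⋂ k, U x k := by rw [hUx]; rfl
      simpa using this
    obtain ⟨𝒱, h𝒱, hc, hl⟩ := hL (insert Hᶜ ((fun x => U x (f x)) '' H))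
      (by
        rintro W (rfl | ⟨x, _, rfl⟩)
        · exact hclosed.isOpen_compl
        · exact hU _ _)
      (by
        intro y _
        by_cases hy : y ∈ H
        · exact ⟨_, Or.inr ⟨y, hy, rfl⟩, hxU _ _⟩
        · exact ⟨_, Or.inl rfl, hy⟩)
    have hr : ∀ W : Set X, ∃ x ∈ H, W ∈ 𝒱 → W = Hᶜ ∨ W = U x (f x) := by
      intro W
      by_cases hW : W ∈ 𝒱
      · rcases h𝒱 hW with h | ⟨x, hx, h⟩
        · exact ⟨x0, hx0, fun _ => Or.inl h⟩
        · exact ⟨x, hx, fun _ => Or.inr h.symm⟩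
      · exact ⟨x0, hx0, fun h => absurd h hW⟩
    choose r hrH hr using hr
    obtain ⟨b, hb⟩ := skl_exists_range (K := K) (Set.insert_nonempty x0 (r '' 𝒱))
      (skl_insert_le _ (Cardinal.mk_image_le.trans hc))
    have hbH : ∀ k, b k ∈ H := by
      intro k
      have : b k ∈ insert x0 (r '' 𝒱) := hb ▸ Set.mem_range_self k
      rcases this with h | ⟨W, _, h⟩
      · exact h ▸ hx0
      · exact h ▸ hrH W
    have hT : g (Set.univ \ ⋃ k, U (b k) (f (b k))) ⊆ H := fun y hy =>
      hH b hbH (Or.inr (Set.mem_iUnion.2 ⟨fun k => f (b k), hy⟩))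
    have hT2 : g (Set.univ \ ⋃ k, U (b k) (f (b k))) ⊆ Set.univ \ ⋃₀ 𝒱 := by
      rintro y hy
      refine ⟨trivial, ?_⟩
      rintro ⟨W, hW, hyW⟩
      rcases hr W hW with h | h
      · exact (h ▸ hyW : y ∈ Hᶜ) (hT hy)
      · have : r W ∈ Set.range b := by rw [hb]; exact Or.inr ⟨W, hW, rfl⟩
        obtain ⟨k, hk⟩ := this
        refine (hgs _ hy).2 (Set.mem_iUnion.2 ⟨k, ?_⟩)
        rw [hk, ← h]
        exact hyW
    have hEq := hge _ ((Cardinal.mk_le_mk_of_subset hT2).trans_lt hl)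
    apply hp
    apply hT
    rw [hEq]
    refine ⟨trivial, fun h => ?_⟩
    obtain ⟨k, hk⟩ := Set.mem_iUnion.1 h
    exact hf _ (hbH k) hk
  have : H = Set.univ := Set.eq_univ_of_forall hall
  rw [this, Cardinal.mk_univ] at hHc
  exact hHc

/-- Theorem 3.8: |X| ≤ 2^{skL(X,2^{ψ(X)t(X)})ψ(X)t(X)}. -/
theorem card_le_two_pow_skL {X : Type u} [TopologicalSpace X] [T2Space X] :
    #X ≤ 2 ^ (skL X (2 ^ (psi X * tight X)) * psi X * tight X) := by
  have hbig : ℵ₀ ≤ max ℵ₀ #(Set X) := le_max_left _ _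
  have hXle : #X ≤ #(Set X) := by rw [Cardinal.mk_set]; exact (Cardinal.cantor _).le
  have hpsi : psi X ∈ {κ : Cardinal.{u} | ℵ₀ ≤ κ ∧
      ∀ x : X, ∃ 𝒱 : Set (Set X), (∀ V ∈ 𝒱, IsOpen V) ∧ #↥𝒱 ≤ κ ∧ ⋂₀ 𝒱 = {x}} := by
    refine csInf_mem ⟨max ℵ₀ #(Set X), hbig, fun x => ⟨(fun y => {y}ᶜ) '' {x}ᶜ, ?_, ?_, ?_⟩⟩
    · rintro _ ⟨y, _, rfl⟩
      exact isOpen_compl_singleton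
    · exact (Cardinal.mk_set_le _).trans (le_max_right _ _)
    · ext z
      simp only [Set.sInter_image, Set.mem_iInter, Set.mem_compl_iff, Set.mem_singleton_iff]
      constructor
      · intro h
        by_contra hz
        exact h z hz rfl
      · rintro rfl y hy rfl
        exact hy rfl
  have htight : tight X ∈ {κ : Cardinal.{u} | ℵ₀ ≤ κ ∧
      ∀ (A : Set X) (x : X), x ∈ closure A → ∃ B ⊆ A, #↥B ≤ κ ∧ x ∈ closure B} := by
    refine csInf_mem ⟨max ℵ₀ #(Set X), hbig, fun A x hx => ⟨A, subset_rfl, ?_, hx⟩⟩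
    exact (Cardinal.mk_set_le _).trans (hXle.trans (le_max_right _ _))
  have hsk : skL X (2 ^ (psi X * tight X)) ∈ {κ : Cardinal.{u} | ℵ₀ ≤ κ ∧
      ∀ 𝒰 : Set (Set X), (∀ U ∈ 𝒰, IsOpen U) → Set.univ ⊆ ⋃₀ 𝒰 →
      ∃ 𝒱 ⊆ 𝒰, #↥𝒱 ≤ κ ∧ #↥(Set.univ \ ⋃₀ 𝒱) < 2 ^ (psi X * tight X)} := by
    refine csInf_mem ⟨max ℵ₀ #(Set X), hbig, fun 𝒰 _ hc => ⟨𝒰, subset_rfl, ?_, ?_⟩⟩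
    · exact (Cardinal.mk_set_le _).trans (le_max_right _ _)
    · rw [Set.diff_eq_empty.2 hc, Cardinal.mk_emptyCollection]
      exact (Cardinal.zero_le _).trans_lt (Cardinal.cantor _)
  obtain ⟨hp0, hp⟩ := hpsi
  obtain ⟨ht0, ht⟩ := htight
  obtain ⟨hs0, hs⟩ := hsk
  generalize hS : skL X (2 ^ (psi X * tight X)) = σ at *
  generalize psi X = ψ at *
  generalize tight X = τ at *
  have one : ∀ {c : Cardinal.{u}}, ℵ₀ ≤ c → c ≠ 0 := fun h h0 => by
    rw [h0] at h; exact absurd h (not_le.2 Cardinal.aleph0_pos)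
  have e1 : σ ≤ σ * ψ * τ := (Cardinal.le_mul_right (one hp0)).trans (Cardinal.le_mul_right (one ht0))
  have e2 : ψ ≤ σ * ψ * τ := (Cardinal.le_mul_left (one hs0)).trans (Cardinal.le_mul_right (one ht0))
  have e3 : τ ≤ σ * ψ * τ := Cardinal.le_mul_left (one (hs0.trans
    (Cardinal.le_mul_right (one hp0))))
  have e4 : ψ * τ ≤ σ * ψ * τ := by rw [mul_assoc]; exact Cardinal.le_mul_left (one hs0)
  obtain ⟨K, hK⟩ : ∃ K : Type u, #K = σ * ψ * τ := ⟨_, Cardinal.mk_out _⟩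
  rw [← hK] at e1 e2 e3 e4 ⊢
  haveI : Infinite K := Cardinal.infinite_iff.2 (hp0.trans e2)
  refine skl_main (2 ^ (ψ * τ)) (Cardinal.power_le_power_left two_ne_zero e4) ?_ ?_ ?_
  · intro 𝒰 h1 h2
    obtain ⟨𝒱, a, b, c⟩ := hs 𝒰 h1 h2
    exact ⟨𝒱, a, b.trans e1, c⟩
  · intro x
    obtain ⟨𝒱, a, b, c⟩ := hp x
    obtain ⟨U, hU⟩ := skl_exists_range (K := K) (Set.insert_nonempty Set.univ 𝒱)
      (skl_insert_le _ (b.trans e2))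
    refine ⟨U, fun k => ?_, ?_⟩
    · have : U k ∈ insert Set.univ 𝒱 := hU ▸ Set.mem_range_self k
      rcases this with h | h
      · exact h ▸ isOpen_univ
      · exact a _ h
    · rw [← Set.sInter_range, hU, Set.sInter_insert, Set.univ_inter, c]
  · intro A x hx
    obtain ⟨B, a, b, c⟩ := ht A x hx
    exact ⟨B, a, b.trans e3, c⟩
end

section
/- If X is a Hausdorff space that is skew-λ Lindelöf where λ = 2^{t(X)·ψ(X)}, then |X| ≤ 2^{t(X)·ψ(X)}. -/
open Cardinal Set

universe u

lemma aux_union_bound {ι X : Type u} (f : ι → Set X) {L : Cardinal.{u}} (hL : ℵ₀ ≤ L)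
    (hι : #ι ≤ L) (h : ∀ i, #(f i) ≤ L) : #(⋃ i, f i) ≤ L := by
  refine (Cardinal.mk_iUnion_le f).trans ?_
  calc #ι * ⨆ i, #(f i) ≤ L * L := by
        gcongr
        exact ciSup_le' h
    _ = L := Cardinal.mul_eq_self hL

lemma aux_pow {κ : Cardinal.{u}} (hκ : ℵ₀ ≤ κ) : ((2 : Cardinal.{u}) ^ κ) ^ κ = 2 ^ κ := by
  rw [← Cardinal.power_mul, Cardinal.mul_eq_self hκ]

lemma aux_inf {κ : Cardinal.{u}} (hκ : ℵ₀ ≤ κ) : ℵ₀ ≤ (2 : Cardinal.{u}) ^ κ :=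
  hκ.trans (Cardinal.cantor κ).le

/-- A nonempty set of size at most `L` is the range of a function on `L.out`. -/
lemma aux_range {X : Type u} {L : Cardinal.{u}} (S : Set X) (hS : S.Nonempty) (h : #S ≤ L) :
    ∃ g : L.out → X, range g = S := by
  have : Nonempty S := hS.to_subtype
  rw [← Cardinal.mk_out L] at h
  obtain ⟨e⟩ := h
  refine ⟨fun i => (Function.invFun e i : S), ?_⟩
  have hs := Function.invFun_surjective e.injective
  ext x
  constructor
  · rintro ⟨i, rfl⟩
    exact Subtype.property _
  · intro hx
    obtain ⟨i, hi⟩ := hs ⟨x, hx⟩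
    exact ⟨i, by simp [hi]⟩

def auxArity (L K : Type u) : Option L → Type u
  | none => PEmpty
  | some _ => K

def auxEval {X : Type u} {L K : Type u} (x0 : X) (step : L → Set X → X) :
    WType (auxArity L K) → X
  | ⟨none, _⟩ => x0
  | ⟨some l, f⟩ => step l (range fun k : K => auxEval x0 step (f k))

lemma aux_closing {X : Type u} {κ : Cardinal.{u}} (hκ : ℵ₀ ≤ κ) (F : Set X → Set X)
    (hF : ∀ B : Set X, #B ≤ κ → #(F B) ≤ 2 ^ κ) (x0 : X) :
    ∃ H : Set X, #H ≤ 2 ^ κ ∧ x0 ∈ H ∧ ∀ B ⊆ H, B.Nonempty → #B ≤ κ → F B ⊆ H := by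
  classical
  have hstep : ∀ B : Set X, ∃ g : ((2 : Cardinal.{u}) ^ κ).out → X, #B ≤ κ → F B ⊆ range g := by
    intro B
    by_cases hB : #B ≤ κ
    · by_cases hne : (F B).Nonempty
      · obtain ⟨g, hg⟩ := aux_range (F B) hne (hF B hB)
        exact ⟨g, fun _ => hg.ge⟩
      · exact ⟨fun _ => x0, fun _ => by simp [Set.not_nonempty_iff_eq_empty.1 hne]⟩
    · exact ⟨fun _ => x0, fun h => absurd h hB⟩
  choose g hg using hstep
  let L := ((2 : Cardinal.{u}) ^ κ).out
  let K := κ.out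
  let ev : WType (auxArity L K) → X := auxEval x0 (fun l B => g B l)
  have hinf := aux_inf hκ
  have hW : #(WType (auxArity L K)) ≤ 2 ^ κ := by
    apply WType.cardinalMk_le_of_le
    have : ∀ a : Option L, ((2 : Cardinal.{u}) ^ κ) ^ #(auxArity L K a) ≤ 2 ^ κ := by
      rintro (_ | l)
      · simp only [auxArity, Cardinal.mk_pempty, Cardinal.power_zero]
        exact Cardinal.one_le_aleph0.trans hinf
      · simp only [auxArity, K, Cardinal.mk_out]
        exact (aux_pow hκ).le
    refine (Cardinal.sum_le_sum _ _ this).trans ?_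
    rw [Cardinal.sum_const', Cardinal.mk_option, Cardinal.mk_out,
      Cardinal.add_one_eq hinf, Cardinal.mul_eq_self hinf]
  refine ⟨range ev, Cardinal.mk_range_le.trans hW, ⟨⟨none, fun z => nomatch z⟩, ?_⟩, ?_⟩
  · simp [ev, auxEval]
  · intro B hBH hBne hB
    obtain ⟨b, hb⟩ := aux_range B hBne hB
    have : ∀ k, ∃ w, ev w = b k := fun k => hBH (hb ▸ mem_range_self k)
    choose w hw using this
    intro y hy
    obtain ⟨l, hl⟩ := hg B hB hy
    refine ⟨⟨some l, w⟩, ?_⟩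
    have h2 : range (fun k : K => ev (w k)) = B := by
      rw [← hb]; congr 1; funext k; exact hw k
    change g (range (fun k : K => ev (w k))) l = y
    rw [h2, hl]

section
variable {X : Type u} [TopologicalSpace X] [T2Space X] {κ : Cardinal.{u}}

lemma aux_psic (hκ : ℵ₀ ≤ κ)
    (hψ : ∀ x : X, ∃ 𝒱 : Set (Set X), (∀ V ∈ 𝒱, IsOpen V) ∧ #↥𝒱 ≤ κ ∧ ⋂₀ 𝒱 = {x})
    (hsk : ∀ 𝒰 : Set (Set X), (∀ U ∈ 𝒰, IsOpen U) → ⋃₀ 𝒰 = Set.univ →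
      ∃ 𝒱 ⊆ 𝒰, #↥𝒱 ≤ ℵ₀ ∧ #↥((Set.univ : Set X) \ ⋃₀ 𝒱) < 2 ^ κ) (x : X) :
    ∃ G : κ.out → Set X, (∀ i, IsOpen (G i) ∧ x ∈ G i) ∧
      #↥(⋂ i, closure (G i)) ≤ 2 ^ κ := by
  obtain ⟨𝒱, hVo, hVc, hVx⟩ := hψ x
  have hinf := aux_inf hκ
  have h1 : ∀ V : 𝒱, ∃ 𝒲 : Set (Set X), (∀ W ∈ 𝒲, x ∉ closure W) ∧ (∀ W ∈ 𝒲, IsOpen W) ∧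
      #𝒲 ≤ κ ∧ #↥((V : Set X)ᶜ \ ⋃₀ 𝒲) ≤ 2 ^ κ := by
    rintro ⟨V, hV⟩
    have hxV : x ∈ V := (hVx.ge (mem_singleton x)) V hV
    obtain ⟨𝒯, hT, hTc, hTl⟩ := hsk (insert V {W | IsOpen W ∧ x ∉ closure W})
      (by
        rintro U (rfl | hU)
        · exact hVo _ hV
        · exact hU.1)
      (by
        refine eq_univ_of_forall fun y => ?_
        by_cases hyx : y = x
        · subst hyx
          exact ⟨V, mem_insert _ _, hxV⟩
        · obtain ⟨A, B, hA, hB, hyA, hxB, hd⟩ := t2_separation hyx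
          refine ⟨A, Or.inr ⟨hA, fun hx => ?_⟩, hyA⟩
          exact (hd.closure_left hB).le_bot ⟨hx, hxB⟩)
    refine ⟨𝒯 \ {V}, ?_, ?_, ?_, ?_⟩
    · rintro W ⟨hW, hne⟩
      exact ((hT hW).resolve_left hne).2
    · rintro W ⟨hW, hne⟩
      exact ((hT hW).resolve_left hne).1
    · exact (Cardinal.mk_le_mk_of_subset sdiff_subset).trans (hTc.trans hκ)
    · refine (Cardinal.mk_le_mk_of_subset ?_).trans hTl.le
      rintro y ⟨hyV, hy⟩
      refine ⟨mem_univ _, ?_⟩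
      rintro ⟨T, hT1, hT2⟩
      refine hy ⟨T, ⟨hT1, ?_⟩, hT2⟩
      rintro rfl
      exact hyV hT2
  choose 𝒲 hW1 hWo hW2 hW3 using h1
  let 𝒢 : Set (Set X) := insert Set.univ (⋃ V : 𝒱, (fun W => (closure W)ᶜ) '' 𝒲 V)
  have hGc : #𝒢 ≤ κ := by
    refine Cardinal.mk_insert_le.trans ?_
    have : #↥(⋃ V : 𝒱, (fun W => (closure W)ᶜ) '' 𝒲 V) ≤ κ :=
      aux_union_bound _ hκ hVc fun V => Cardinal.mk_image_le.trans (hW2 V)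
    calc _ ≤ κ + 1 := by gcongr
      _ = κ := Cardinal.add_one_eq hκ
  obtain ⟨G, hG⟩ := aux_range 𝒢 ⟨Set.univ, mem_insert _ _⟩ hGc
  refine ⟨G, fun i => ?_, ?_⟩
  · have : G i ∈ 𝒢 := hG ▸ mem_range_self i
    rcases this with h | h
    · rw [h]; exact ⟨isOpen_univ, mem_univ _⟩
    · obtain ⟨V, W, hW, h⟩ := mem_iUnion.1 h
      rw [← h]
      exact ⟨isClosed_closure.isOpen_compl, hW1 V W hW⟩
  · have hsub : (⋂ i, closure (G i)) ⊆ insert x (⋃ V : 𝒱, ((V : Set X)ᶜ \ ⋃₀ 𝒲 V)) := by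
      intro y hy
      by_cases hyx : y = x
      · exact Or.inl hyx
      right
      have : y ∉ ⋂₀ 𝒱 := by rw [hVx]; exact hyx
      obtain ⟨V, hV, hyV⟩ : ∃ V ∈ 𝒱, y ∉ V := by simpa [mem_sInter] using this
      refine mem_iUnion.2 ⟨⟨V, hV⟩, hyV, ?_⟩
      rintro ⟨W, hW, hyW⟩
      have hmem : (closure W)ᶜ ∈ 𝒢 := Or.inr (mem_iUnion.2 ⟨⟨V, hV⟩, W, hW, rfl⟩)
      rw [← hG] at hmem
      obtain ⟨i, hi⟩ := hmem
      have hyi := mem_iInter.1 hy i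
      rw [hi] at hyi
      have hd : Disjoint (closure W)ᶜ W :=
        (disjoint_compl_left (a := closure W)).mono_right subset_closure
      exact (hd.closure_left (hWo _ W hW)).le_bot ⟨hyi, hyW⟩
    refine (Cardinal.mk_le_mk_of_subset hsub).trans (Cardinal.mk_insert_le.trans ?_)
    have := aux_union_bound (fun V : 𝒱 => ((V : Set X)ᶜ \ ⋃₀ 𝒲 V)) hinf
      (hVc.trans (Cardinal.cantor κ).le) hW3
    calc _ ≤ (2 : Cardinal.{u}) ^ κ + 1 := by gcongr
      _ = _ := Cardinal.add_one_eq hinf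

lemma aux_closure (hκ : ℵ₀ ≤ κ)
    (ht : ∀ (A : Set X) (x : X), x ∈ closure A → ∃ B ⊆ A, #↥B ≤ κ ∧ x ∈ closure B)
    (hc : ∀ x : X, ∃ G : κ.out → Set X, (∀ i, IsOpen (G i) ∧ x ∈ G i) ∧
      #↥(⋂ i, closure (G i)) ≤ 2 ^ κ) (A : Set X) (hA : #A ≤ 2 ^ κ) :
    #↥(closure A) ≤ 2 ^ κ := by
  have hinf := aux_inf hκ
  choose G hG hGc using hc
  let Code := (κ.out → A) × (κ.out → Set κ.out)
  have hCode : #Code ≤ 2 ^ κ := by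
    simp only [Code, Cardinal.mk_prod, Cardinal.lift_id, ← Cardinal.power_def, Cardinal.mk_out,
      Cardinal.mk_set]
    rw [aux_pow hκ]
    calc #A ^ κ * 2 ^ κ ≤ (2 ^ κ) ^ κ * 2 ^ κ :=
          mul_le_mul_left (Cardinal.power_le_power_right hA) _
      _ = 2 ^ κ := by rw [aux_pow hκ, Cardinal.mul_eq_self hinf]
  let fib : Code → Set X := fun c => {x | (∀ i, c.2 i = {k | (c.1 k : X) ∈ G x i}) ∧
    x ∈ closure (range fun k => (c.1 k : X))}
  have hfib : ∀ c x, x ∈ fib c → ∀ i, x ∈ closure ((fun k => (c.1 k : X)) '' c.2 i) := by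
    rintro c x ⟨h1, h2⟩ i
    have : (fun k => (c.1 k : X)) '' c.2 i = G x i ∩ range fun k => (c.1 k : X) := by
      rw [h1]
      ext y
      constructor
      · rintro ⟨k, hk, rfl⟩
        exact ⟨hk, k, rfl⟩
      · rintro ⟨hk, k, rfl⟩
        exact ⟨k, hk, rfl⟩
    rw [this]
    exact (hG x i).1.inter_closure ⟨(hG x i).2, h2⟩
  have hsub : closure A ⊆ ⋃ c, fib c := by
    intro x hx
    obtain ⟨B, hBA, hB, hxB⟩ := ht A x hx
    obtain ⟨b, hb⟩ := aux_range B (closure_nonempty_iff.1 ⟨x, hxB⟩) hB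
    refine mem_iUnion.2 ⟨⟨fun k => ⟨b k, hBA (hb ▸ mem_range_self k)⟩,
      fun i => {k | b k ∈ G x i}⟩, fun i => rfl, ?_⟩
    change x ∈ closure (range fun k => b k)
    rwa [hb]
  refine (Cardinal.mk_le_mk_of_subset hsub).trans (aux_union_bound _ hinf hCode fun c => ?_)
  rcases (fib c).eq_empty_or_nonempty with h | ⟨x, hx⟩
  · rw [h]; simp
  · refine (Cardinal.mk_le_mk_of_subset ?_).trans (hGc x)
    intro z hz
    refine mem_iInter.2 fun i => closure_mono ?_ (hfib c z hz i)
    rw [hx.1 i]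
    rintro _ ⟨k, hk, rfl⟩
    exact hk

lemma aux_main (hκ : ℵ₀ ≤ κ)
    (ht : ∀ (A : Set X) (x : X), x ∈ closure A → ∃ B ⊆ A, #↥B ≤ κ ∧ x ∈ closure B)
    (hψ : ∀ x : X, ∃ 𝒱 : Set (Set X), (∀ V ∈ 𝒱, IsOpen V) ∧ #↥𝒱 ≤ κ ∧ ⋂₀ 𝒱 = {x})
    (hsk : ∀ 𝒰 : Set (Set X), (∀ U ∈ 𝒰, IsOpen U) → ⋃₀ 𝒰 = Set.univ →
      ∃ 𝒱 ⊆ 𝒰, #↥𝒱 ≤ ℵ₀ ∧ #↥((Set.univ : Set X) \ ⋃₀ 𝒱) < 2 ^ κ) :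
    #X ≤ 2 ^ κ := by
  classical
  have hinf := aux_inf hκ
  have hcl := aux_closure hκ ht (aux_psic hκ hψ hsk)
  rcases isEmpty_or_nonempty X with hX | ⟨⟨x0⟩⟩
  · simp
  choose P hPo hPc hPx using hψ
  have hS : ∀ C : Set X, ∃ S ⊆ C, #S ≤ 2 ^ κ ∧ (#S < 2 ^ κ → S = C) := by
    intro C
    by_cases h : #C < 2 ^ κ
    · exact ⟨C, Subset.rfl, h.le, fun _ => rfl⟩
    · obtain ⟨S, hS, hSc⟩ := Cardinal.le_mk_iff_exists_subset.1 (not_lt.1 h)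
      exact ⟨S, hS, hSc.le, fun h' => absurd hSc h'.ne⟩
  choose S hSC hSc hSeq using hS
  let F : Set X → Set X := fun B => closure B ∪
    ⋃ 𝒱 : Set ↥(⋃ x : B, P x), S (⋃₀ (Subtype.val '' 𝒱))ᶜ
  obtain ⟨H, hHc, hx0, hH⟩ := aux_closing hκ F (fun B hB => by
    refine (Cardinal.mk_union_le _ _).trans ?_
    have h1 := hcl B (hB.trans (Cardinal.cantor κ).le)
    have h2 : #↥(⋃ 𝒱 : Set ↥(⋃ x : B, P x), S (⋃₀ (Subtype.val '' 𝒱))ᶜ) ≤ 2 ^ κ := by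
      refine aux_union_bound _ hinf ?_ fun _ => hSc _
      rw [Cardinal.mk_set]
      exact Cardinal.power_le_power_left two_ne_zero
        (aux_union_bound _ hκ hB fun x => hPc x)
    calc _ ≤ (2 : Cardinal.{u}) ^ κ + 2 ^ κ := add_le_add h1 h2
      _ = _ := Cardinal.add_eq_self hinf) x0
  have hHcl : IsClosed H := by
    rw [← closure_subset_iff_isClosed]
    intro x hx
    obtain ⟨B, hBH, hB, hxB⟩ := ht H x hx
    exact hH B hBH (closure_nonempty_iff.1 ⟨x, hxB⟩) hB (Or.inl hxB)
  suffices h : H = Set.univ by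
    rw [← Cardinal.mk_univ, ← h]; exact hHc
  by_contra hne
  obtain ⟨q, hq⟩ := (ne_univ_iff_exists_notMem H).1 hne
  have hV : ∀ x : H, ∃ V ∈ P x, q ∉ V := by
    intro x
    have : q ∉ ⋂₀ P x := by
      rw [hPx]; rintro rfl; exact hq x.2
    simpa [mem_sInter] using this
  choose V hVP hVq using hV
  have hxV : ∀ x : H, (x : X) ∈ V x := fun x => ((hPx x).ge (mem_singleton _)) _ (hVP x)
  obtain ⟨𝒯, hT, hTc, hTl⟩ := hsk (insert Hᶜ (range V))
    (by
      rintro U (rfl | ⟨x, rfl⟩)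
      · exact hHcl.isOpen_compl
      · exact hPo _ _ (hVP x))
    (by
      refine eq_univ_of_forall fun y => ?_
      by_cases hy : y ∈ H
      · exact ⟨V ⟨y, hy⟩, Or.inr ⟨_, rfl⟩, hxV ⟨y, hy⟩⟩
      · exact ⟨Hᶜ, mem_insert _ _, hy⟩)
  have h3 : ∀ T : ↥(𝒯 \ {Hᶜ}), ∃ x : H, V x = T := fun T => (hT T.2.1).resolve_left T.2.2
  choose r hr using h3
  let B : Set X := insert x0 (range fun T => (r T : X))
  have hBH : B ⊆ H := by
    rintro _ (rfl | ⟨T, rfl⟩)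
    · exact hx0
    · exact (r T).2
  have hBc : #B ≤ κ := by
    refine Cardinal.mk_insert_le.trans ?_
    have : #↥(range fun T => (r T : X)) ≤ κ := by
      refine Cardinal.mk_range_le.trans ?_
      exact (Cardinal.mk_le_mk_of_subset sdiff_subset).trans (hTc.trans hκ)
    calc _ ≤ κ + 1 := by gcongr
      _ = κ := Cardinal.add_one_eq hκ
  have hFB := hH B hBH ⟨x0, mem_insert _ _⟩ hBc
  have hsubP : 𝒯 \ {Hᶜ} ⊆ ⋃ x : B, P x := by
    intro T hTm
    refine mem_iUnion.2 ⟨⟨r ⟨T, hTm⟩, Or.inr ⟨⟨T, hTm⟩, rfl⟩⟩, ?_⟩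
    have := hVP (r ⟨T, hTm⟩)
    rwa [hr] at this
  have hSH : S (⋃₀ (𝒯 \ {Hᶜ}))ᶜ ⊆ H := by
    refine Subset.trans ?_ hFB
    refine Subset.trans ?_ subset_union_right
    have : Subtype.val '' ((Subtype.val : ↥(⋃ x : B, P x) → Set X) ⁻¹' (𝒯 \ {Hᶜ})) = 𝒯 \ {Hᶜ} := by
      rw [Subtype.image_preimage_coe, inter_eq_right]
      exact hsubP
    refine Subset.trans ?_ (subset_iUnion _
      ((Subtype.val : ↥(⋃ x : B, P x) → Set X) ⁻¹' (𝒯 \ {Hᶜ})))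
    rw [this]
  have hlt : #↥(S (⋃₀ (𝒯 \ {Hᶜ}))ᶜ) < 2 ^ κ := by
    refine (Cardinal.mk_le_mk_of_subset ?_).trans_lt hTl
    intro y hy
    refine ⟨mem_univ _, ?_⟩
    rintro ⟨T, hT1, hT2⟩
    refine hSC _ hy ⟨T, ⟨hT1, ?_⟩, hT2⟩
    rintro rfl
    exact hT2 (hSH hy)
  have heq := hSeq _ hlt
  apply hq
  apply hSH
  rw [heq]
  rintro ⟨T, hTm, hqT⟩
  have := hVq (r ⟨T, hTm⟩)
  rw [hr] at this
  exact this hqT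

end

/-- Corollary 3.10: if X is skew-λ Lindelöf for λ = 2^{t(X)ψ(X)}, then |X| ≤ 2^{t(X)ψ(X)}. -/
theorem card_le_of_skew_lindelof {X : Type u} [TopologicalSpace X] [T2Space X]
    (hsk : ∀ 𝒰 : Set (Set X), (∀ U ∈ 𝒰, IsOpen U) → ⋃₀ 𝒰 = Set.univ →
      ∃ 𝒱 ⊆ 𝒰, #↥𝒱 ≤ ℵ₀ ∧ #↥((Set.univ : Set X) \ ⋃₀ 𝒱) < 2 ^ (tight X * psi X)) :
    #X ≤ 2 ^ (tight X * psi X) := by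
  have ht : tight X ∈ {κ : Cardinal.{u} | ℵ₀ ≤ κ ∧
      ∀ (A : Set X) (x : X), x ∈ closure A → ∃ B ⊆ A, #↥B ≤ κ ∧ x ∈ closure B} :=
    csInf_mem ⟨max ℵ₀ #X, le_max_left _ _, fun A x hx =>
      ⟨A, Subset.rfl, (Cardinal.mk_set_le A).trans (le_max_right _ _), hx⟩⟩
  have hp : psi X ∈ {κ : Cardinal.{u} | ℵ₀ ≤ κ ∧
      ∀ x : X, ∃ 𝒱 : Set (Set X), (∀ V ∈ 𝒱, IsOpen V) ∧ #↥𝒱 ≤ κ ∧ ⋂₀ 𝒱 = {x}} := by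
    refine csInf_mem ⟨max ℵ₀ #(Set X), le_max_left _ _, fun x =>
      ⟨{V | IsOpen V ∧ x ∈ V}, fun V hV => hV.1,
        (Cardinal.mk_set_le _).trans (le_max_right _ _), ?_⟩⟩
    ext y
    constructor
    · intro hy
      by_contra hne
      exact hy {y}ᶜ ⟨isOpen_compl_singleton, fun h => hne (Eq.symm h)⟩ rfl
    · rintro rfl V hV
      exact hV.2
  have ht0 : tight X ≠ 0 := (Cardinal.aleph0_pos.trans_le ht.1).ne'
  have hp0 : psi X ≠ 0 := (Cardinal.aleph0_pos.trans_le hp.1).ne'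
  have h1 : tight X ≤ tight X * psi X := Cardinal.le_mul_right hp0
  have h2 : psi X ≤ tight X * psi X := Cardinal.le_mul_left ht0
  refine aux_main (ht.1.trans h1) (fun A x hx => ?_) (fun x => ?_) hsk
  · obtain ⟨B, hB, hc, hxB⟩ := ht.2 A x hx
    exact ⟨B, hB, hc.trans h1, hxB⟩
  · obtain ⟨V, hV, hc, hx⟩ := hp.2 x
    exact ⟨V, hV, hc.trans h2, hx⟩
end

section
/- Let X be a Hausdorff space and κ, λ infinite cardinals. If t(X) ≤ κ, then saL_κ(X,λ) = saL_c(X,λ). -/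
open Cardinal Set

universe u

theorem clk_eq_iff_isClosed_aux {X : Type u} [TopologicalSpace X]
    (κ : Cardinal.{u}) (ht : tight X ≤ κ) (A : Set X) : clk κ A = A ↔ IsClosed A := by
  have hmem : tight X ∈ {κ : Cardinal.{u} | ℵ₀ ≤ κ ∧
      ∀ (A : Set X) (x : X), x ∈ closure A → ∃ B ⊆ A, #↥B ≤ κ ∧ x ∈ closure B} := by
    apply csInf_mem
    refine ⟨max ℵ₀ #X, le_max_left _ _, fun A x hx => ⟨A, subset_rfl, ?_, hx⟩⟩
    exact (mk_set_le A).trans (le_max_right _ _)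
  have hcl : clk κ A = closure A := by
    apply Set.Subset.antisymm
    · exact Set.iUnion₂_subset fun B hB => closure_mono hB.1
    · intro x hx
      obtain ⟨B, hBA, hB, hxB⟩ := hmem.2 A x hx
      exact Set.mem_biUnion (show B ∈ {B : Set X | B ⊆ A ∧ #↥B ≤ κ} from
        ⟨hBA, hB.trans ht⟩) hxB
  rw [hcl, closure_eq_iff_isClosed]

/-- Proposition 4.2(e): if t(X) ≤ κ, then saL_κ(X,λ) = saL_c(X,λ). -/
theorem saLk_eq_saLc_of_tight_le {X : Type u} [TopologicalSpace X] [T2Space X]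
    (κ lam : Cardinal.{u}) (hκ : ℵ₀ ≤ κ) (hlam : ℵ₀ ≤ lam) (ht : tight X ≤ κ) :
    saLk X κ lam = saLc X lam := by
  simp only [saLk, saLc, clk_eq_iff_isClosed_aux κ ht]
end

section
/- For any Hausdorff space X and infinite cardinal λ, the set {κ : κ is an infinite cardinal, κ ≥ ψ_c(X), and κ ≥ saL_κ(X,λ)} is nonempty; in particular κ = t(X) · ψ_c(X) · saL_c(X,ω₁) belongs to this set. -/
open Cardinal Set

universe u

theorem aux_saLrel_le (X : Type u) [TopologicalSpace X] (A : Set X) (lam : Cardinal.{u})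
    (hlam : ℵ₀ ≤ lam) : max ℵ₀ #(Set X) ∈ {κ : Cardinal.{u} | ℵ₀ ≤ κ ∧
    ∀ 𝒰 : Set (Set X), (∀ U ∈ 𝒰, IsOpen U) → A ⊆ ⋃₀ 𝒰 →
      ∃ 𝒱 ⊆ 𝒰, #↥𝒱 ≤ κ ∧ #↥(A \ ⋃ V ∈ 𝒱, closure V) < lam} := by
  refine ⟨le_max_left _ _, fun 𝒰 _ hA => ⟨𝒰, Subset.rfl, ?_, ?_⟩⟩
  · exact (mk_set_le 𝒰).trans (le_max_right _ _)
  · have : A \ ⋃ V ∈ 𝒰, closure V = ∅ := by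
      rw [Set.diff_eq_empty]
      intro x hx
      obtain ⟨U, hU, hxU⟩ := hA hx
      exact mem_iUnion₂.2 ⟨U, hU, subset_closure hxU⟩
    rw [this, mk_emptyCollection]
    exact aleph0_pos.trans_le hlam

theorem aux_saLrel_spec (X : Type u) [TopologicalSpace X] (A : Set X) (lam : Cardinal.{u})
    (hlam : ℵ₀ ≤ lam) : saLrel X A lam ∈ {κ : Cardinal.{u} | ℵ₀ ≤ κ ∧
    ∀ 𝒰 : Set (Set X), (∀ U ∈ 𝒰, IsOpen U) → A ⊆ ⋃₀ 𝒰 →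
      ∃ 𝒱 ⊆ 𝒰, #↥𝒱 ≤ κ ∧ #↥(A \ ⋃ V ∈ 𝒱, closure V) < lam} :=
  csInf_mem ⟨_, aux_saLrel_le X A lam hlam⟩

theorem aux_saLrel_le_saLc (X : Type u) [TopologicalSpace X] (A : Set X) (hA : IsClosed A)
    (lam : Cardinal.{u}) (hlam : ℵ₀ ≤ lam) : saLrel X A lam ≤ saLc X lam := by
  refine le_csSup ⟨max ℵ₀ #(Set X), ?_⟩ ⟨A, hA, rfl⟩
  rintro c ⟨B, _, rfl⟩
  exact csInf_le' (aux_saLrel_le X B lam hlam)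

theorem aux_tight_spec (X : Type u) [TopologicalSpace X] :
    tight X ∈ {κ : Cardinal.{u} | ℵ₀ ≤ κ ∧
    ∀ (A : Set X) (x : X), x ∈ closure A → ∃ B ⊆ A, #↥B ≤ κ ∧ x ∈ closure B} :=
  csInf_mem ⟨max ℵ₀ #X, le_max_left _ _, fun A _ hx =>
    ⟨A, Subset.rfl, (mk_set_le A).trans (le_max_right _ _), hx⟩⟩

theorem aux_aleph0_le_psic (X : Type u) [TopologicalSpace X] [T2Space X] : ℵ₀ ≤ psic X := by
  have h : psic X ∈ {κ : Cardinal.{u} | ℵ₀ ≤ κ ∧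
    ∀ x : X, ∃ 𝒱 : Set (Set X), (∀ V ∈ 𝒱, IsOpen V ∧ x ∈ V) ∧ #↥𝒱 ≤ κ ∧
      (⋂ V ∈ 𝒱, closure V) = {x}} := by
    refine csInf_mem ⟨max ℵ₀ #(Set X), le_max_left _ _, fun x =>
      ⟨{V | IsOpen V ∧ x ∈ V}, fun V hV => hV, (mk_set_le _).trans (le_max_right _ _), ?_⟩⟩
    ext y
    simp only [mem_iInter, mem_singleton_iff, mem_setOf_eq]
    constructor
    · intro h
      by_contra hne
      obtain ⟨U, V, hU, hV, hyU, hxV, hd⟩ := t2_separation hne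
      have := mem_closure_iff.1 (h V ⟨hV, hxV⟩) U hU hyU
      exact this.ne_empty hd.inter_eq
    · rintro rfl V hV
      exact subset_closure hV.2
  exact h.1

theorem aux_closed_saLrel (X : Type u) [TopologicalSpace X] (A : Set X)
    (lam : Cardinal.{u}) (hlam : ℵ₀ ≤ lam) :
    saLrel X A lam ≤ saLrel X A (Cardinal.aleph 1) := by
  obtain ⟨h0, h⟩ := aux_saLrel_spec X A (Cardinal.aleph 1) (aleph0_le_aleph 1)
  refine csInf_le' ⟨h0, fun 𝒰 hU hA => ?_⟩
  obtain ⟨𝒱, hV, hVc, hl⟩ := h 𝒰 hU hA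
  have hl' : #↥(A \ ⋃ V ∈ 𝒱, closure V) ≤ ℵ₀ := by
    rw [← Order.lt_succ_iff, succ_aleph0]
    exact hl
  have hch : ∀ x : ↥(A \ ⋃ V ∈ 𝒱, closure V), ∃ U ∈ 𝒰, (x : X) ∈ U := fun x => hA x.2.1
  choose f hf hxf using hch
  refine ⟨𝒱 ∪ range f, union_subset hV (range_subset_iff.2 hf), ?_, ?_⟩
  · refine (mk_union_le _ _).trans ?_
    exact add_le_of_le h0 hVc ((mk_range_le.trans hl').trans h0)
  · have : A \ ⋃ V ∈ 𝒱 ∪ range f, closure V = ∅ := by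
      rw [Set.diff_eq_empty]
      intro x hx
      by_cases hxV : x ∈ ⋃ V ∈ 𝒱, closure V
      · obtain ⟨V, hV, hxV⟩ := mem_iUnion₂.1 hxV
        exact mem_iUnion₂.2 ⟨V, Or.inl hV, hxV⟩
      · exact mem_iUnion₂.2 ⟨f ⟨x, hx, hxV⟩, Or.inr ⟨_, rfl⟩, subset_closure (hxf ⟨x, hx, hxV⟩)⟩
    rw [this, mk_emptyCollection]
    exact aleph0_pos.trans_le hlam

/-- Lemma 4.3: {κ : κ ≥ ψ_c(X), κ ≥ saL_κ(X,λ)} is nonempty; in particular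
κ = t(X)·ψ_c(X)·saL_c(X,ω₁) belongs to it. -/
theorem saLk_good_set_nonempty {X : Type u} [TopologicalSpace X] [T2Space X]
    (lam : Cardinal.{u}) (hlam : ℵ₀ ≤ lam) :
    tight X * psic X * saLc X (Cardinal.aleph 1) ∈
      {κ : Cardinal.{u} | ℵ₀ ≤ κ ∧ psic X ≤ κ ∧ saLk X κ lam ≤ κ} ∧
    {κ : Cardinal.{u} | ℵ₀ ≤ κ ∧ psic X ≤ κ ∧ saLk X κ lam ≤ κ}.Nonempty := by
  have ht := aux_tight_spec X
  have hp := aux_aleph0_le_psic X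
  have hs : ℵ₀ ≤ saLc X (Cardinal.aleph 1) :=
    (aux_saLrel_spec X ∅ _ (aleph0_le_aleph 1)).1.trans
      (aux_saLrel_le_saLc X ∅ isClosed_empty _ (aleph0_le_aleph 1))
  have t0 : tight X ≠ 0 := (aleph0_pos.trans_le ht.1).ne'
  have p0 : psic X ≠ 0 := (aleph0_pos.trans_le hp).ne'
  have s0 : saLc X (Cardinal.aleph 1) ≠ 0 := (aleph0_pos.trans_le hs).ne'
  have key : tight X * psic X * saLc X (Cardinal.aleph 1) ∈
      {κ : Cardinal.{u} | ℵ₀ ≤ κ ∧ psic X ≤ κ ∧ saLk X κ lam ≤ κ} := by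
    have h1 : tight X ≤ tight X * psic X * saLc X (Cardinal.aleph 1) :=
      (le_mul_right p0).trans (le_mul_right s0)
    refine ⟨ht.1.trans h1, (le_mul_left t0).trans (le_mul_right s0), csSup_le' ?_⟩
    rintro c ⟨A, hA, rfl⟩
    have hcl : IsClosed A := by
      refine isClosed_of_closure_subset fun x hx => ?_
      obtain ⟨B, hB, hBc, hxB⟩ := ht.2 A x hx
      rw [← hA]
      exact mem_iUnion₂.2 ⟨B, ⟨hB, hBc.trans h1⟩, hxB⟩
    exact (aux_closed_saLrel X A lam hlam).trans
      ((aux_saLrel_le_saLc X A hcl _ (aleph0_le_aleph 1)).trans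
        (le_mul_left (mul_ne_zero t0 p0)))
  exact ⟨key, _, key⟩
end

section
/- Let X be a Hausdorff space and κ an infinite cardinal such that ψ_c(X) ≤ κ and saL_κ(X, 2^κ) ≤ κ. Then |X| ≤ 2^κ. -/
open Cardinal Set

universe u

/-- A set of size at most `#K` inside a nonempty set `A` is contained in the range of a map `K → A`. -/
theorem exists_enum {Y K : Type u} (A : Set Y) (a : Y) (ha : a ∈ A) (S : Set Y) (hS : S ⊆ A)
    (hc : #↥S ≤ #K) : ∃ f : K → Y, (∀ k, f k ∈ A) ∧ S ⊆ Set.range f := by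
  obtain ⟨e⟩ := hc
  classical
  refine ⟨fun k => if h : ∃ s : S, e s = k then (h.choose : Y) else a, ?_, ?_⟩
  · intro k
    dsimp only
    split_ifs with h
    · exact hS h.choose.2
    · exact ha
  · intro y hy
    have h : ∃ s : S, e s = e ⟨y, hy⟩ := ⟨_, rfl⟩
    refine ⟨e ⟨y, hy⟩, ?_⟩
    dsimp only
    rw [dif_pos h]
    have := e.injective h.choose_spec
    rw [this]

theorem two_pow_pow (κ : Cardinal.{u}) (hκ : ℵ₀ ≤ κ) : ((2 : Cardinal.{u}) ^ κ) ^ κ = 2 ^ κ := by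
  rw [← Cardinal.power_mul, Cardinal.mul_eq_self hκ]

/-- Closing-off lemma. -/
theorem closing_off {X K : Type u} (κ : Cardinal.{u}) (hκ : ℵ₀ ≤ κ) (hK : #K = κ) (x0 : X)
    (F : (K → X) → Set X) (hF : ∀ f, #↥(F f) ≤ 2 ^ κ) :
    ∃ A : Set X, x0 ∈ A ∧ #↥A ≤ 2 ^ κ ∧ ∀ f : K → X, (∀ k, f k ∈ A) → F f ⊆ A := by
  have h1 : ℵ₀ ≤ (2 : Cardinal.{u}) ^ κ := hκ.trans (Cardinal.cantor κ).le
  let T : Type u := ((2 : Cardinal.{u}) ^ κ).out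
  have hT : #T = 2 ^ κ := Cardinal.mk_out _
  have hg : ∀ f : K → X, ∃ g : T → X, F f ⊆ Set.range g := by
    intro f
    obtain ⟨g, -, hg⟩ := exists_enum (K := T) Set.univ x0 trivial (F f) (Set.subset_univ _)
      (by rw [hT]; exact hF f)
    exact ⟨g, hg⟩
  choose g hg using hg
  let β : Option T → Type u := fun o => Option.rec PEmpty (fun _ => K) o
  let ev : WType β → X := WType.elim X (fun p => match p with
    | ⟨none, _⟩ => x0
    | ⟨some t, f⟩ => g f t)
  refine ⟨Set.range ev, ⟨WType.mk none PEmpty.elim, rfl⟩, ?_, ?_⟩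
  · refine Cardinal.mk_range_le.trans ?_
    refine WType.cardinalMk_le_of_le' ?_
    refine (Cardinal.sum_le_sum _ (fun _ => 2 ^ κ) ?_).trans ?_
    · rintro (_ | t)
      · simp only [β, Cardinal.mk_pempty, Cardinal.lift_zero, Cardinal.power_zero]
        exact Cardinal.one_le_aleph0.trans h1
      · rw [Cardinal.lift_id]
        change ((2 : Cardinal.{u}) ^ κ) ^ #K ≤ _
        rw [hK, two_pow_pow κ hκ]
    · rw [Cardinal.sum_const', Cardinal.mk_option, hT,
        Cardinal.add_one_eq h1, Cardinal.mul_eq_self h1]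
  · intro f hf x hx
    choose w hw using hf
    obtain ⟨t, ht⟩ := hg f hx
    refine ⟨WType.mk (some t) w, ?_⟩
    have : (fun k => ev (w k)) = f := funext hw
    rw [← ht, ← this]
    rfl

theorem exists_psic_fun {X K : Type u} [TopologicalSpace X] [T2Space X]
    (κ : Cardinal.{u}) (hκ : ℵ₀ ≤ κ) (hK : #K = κ) (hpsic : psic X ≤ κ) :
    ∃ v : X → K → Set X, (∀ x k, IsOpen (v x k)) ∧ (∀ x k, x ∈ v x k) ∧
      ∀ x y, (∀ k, y ∈ closure (v x k)) → y = x := by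
  have hne : {κ : Cardinal.{u} | ℵ₀ ≤ κ ∧
    ∀ x : X, ∃ 𝒱 : Set (Set X), (∀ V ∈ 𝒱, IsOpen V ∧ x ∈ V) ∧ #↥𝒱 ≤ κ ∧
      (⋂ V ∈ 𝒱, closure V) = {x}}.Nonempty := by
    refine ⟨max ℵ₀ #(Set X), le_max_left _ _, fun x => ⟨{V | IsOpen V ∧ x ∈ V}, fun V h => h,
      (Cardinal.mk_set_le _).trans (le_max_right _ _), ?_⟩⟩
    ext y
    simp only [Set.mem_iInter, Set.mem_singleton_iff]
    constructor
    · intro h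
      by_contra hxy
      obtain ⟨U, V, hU, hV, hyU, hxV, hd⟩ := t2_separation hxy
      have := h V ⟨hV, hxV⟩
      rw [mem_closure_iff] at this
      obtain ⟨z, hz1, hz2⟩ := this U hU hyU
      exact Set.disjoint_left.1 hd hz1 hz2
    · rintro rfl V hV
      exact subset_closure hV.2
  have hm := (csInf_mem hne).2
  have : ∀ x : X, ∃ w : K → Set X, (∀ k, IsOpen (w k)) ∧ (∀ k, x ∈ w k) ∧
      ∀ y, (∀ k, y ∈ closure (w k)) → y = x := by
    intro x
    obtain ⟨𝒱, h1, h2, h3⟩ := hm x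
    obtain ⟨w, hw1, hw2⟩ := exists_enum (K := K) {V : Set X | IsOpen V ∧ x ∈ V} Set.univ
      ⟨isOpen_univ, trivial⟩ 𝒱 h1 (by rw [hK]; exact h2.trans hpsic)
    refine ⟨w, fun k => (hw1 k).1, fun k => (hw1 k).2, fun y hy => ?_⟩
    have : y ∈ (⋂ V ∈ 𝒱, closure V) := by
      simp only [Set.mem_iInter]
      intro V hV
      obtain ⟨k, rfl⟩ := hw2 hV
      exact hy k
    rw [h3] at this
    exact this
  choose v h1 h2 h3 using this
  exact ⟨v, h1, h2, h3⟩

theorem saLk_apply {X : Type u} [TopologicalSpace X]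
    (κ : Cardinal.{u}) (hsaL : saLk X κ (2 ^ κ) ≤ κ) (A : Set X)
    (hA : clk κ A = A) (𝒰 : Set (Set X)) (ho : ∀ U ∈ 𝒰, IsOpen U) (hc : A ⊆ ⋃₀ 𝒰) :
    ∃ 𝒱 ⊆ 𝒰, #↥𝒱 ≤ κ ∧ #↥(A \ ⋃ V ∈ 𝒱, closure V) < 2 ^ κ := by
  have hb : BddAbove {c : Cardinal.{u} | ∃ A : Set X, clk κ A = A ∧ c = saLrel X A (2 ^ κ)} := by
    refine BddAbove.mono ?_ (Cardinal.bddAbove_range (fun A : Set X => saLrel X A (2 ^ κ)))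
    rintro c ⟨A, -, rfl⟩
    exact ⟨A, rfl⟩
  have h1 : saLrel X A (2 ^ κ) ≤ κ := (le_csSup hb ⟨A, hA, rfl⟩).trans hsaL
  have hne : {κ' : Cardinal.{u} | ℵ₀ ≤ κ' ∧
    ∀ 𝒰 : Set (Set X), (∀ U ∈ 𝒰, IsOpen U) → A ⊆ ⋃₀ 𝒰 →
      ∃ 𝒱 ⊆ 𝒰, #↥𝒱 ≤ κ' ∧ #↥(A \ ⋃ V ∈ 𝒱, closure V) < 2 ^ κ}.Nonempty := by
    refine ⟨max ℵ₀ #(Set X), le_max_left _ _, fun 𝒰 _ hc => ⟨𝒰, subset_rfl,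
      (Cardinal.mk_set_le _).trans (le_max_right _ _), ?_⟩⟩
    have : A \ ⋃ V ∈ 𝒰, closure V = ∅ := by
      rw [Set.diff_eq_empty]
      intro x hx
      obtain ⟨U, hU, hxU⟩ := hc hx
      exact Set.mem_biUnion hU (subset_closure hxU)
    rw [this, Cardinal.mk_emptyCollection]
    exact Cardinal.power_pos _ two_pos
  obtain ⟨𝒱, h2, h3, h4⟩ := (csInf_mem hne).2 𝒰 ho hc
  exact ⟨𝒱, h2, h3.trans h1, h4⟩

theorem mk_closure_range_le {X K : Type u} [TopologicalSpace X]
    (κ : Cardinal.{u}) (hκ : ℵ₀ ≤ κ) (hK : #K = κ) (v : X → K → Set X)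
    (hv1 : ∀ x k, IsOpen (v x k)) (hv2 : ∀ x k, x ∈ v x k)
    (hv3 : ∀ x y, (∀ k, y ∈ closure (v x k)) → y = x) (f : K → X) :
    #↥(closure (Set.range f)) ≤ 2 ^ κ := by
  have h : #(K → Set K) = 2 ^ κ := by
    rw [← Cardinal.power_def, Cardinal.mk_set, hK, two_pow_pow κ hκ]
  rw [← h]
  refine Cardinal.mk_le_of_injective
    (f := fun (x : closure (Set.range f)) (k : K) => {j | f j ∈ v x.1 k}) ?_
  rintro ⟨x, hx⟩ ⟨y, hy⟩ hxy
  rw [Subtype.mk.injEq]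
  refine (hv3 x y fun k => ?_).symm
  have hk : {j | f j ∈ v x k} = {j | f j ∈ v y k} := congrFun hxy k
  rw [mem_closure_iff]
  intro U hU hyU
  obtain ⟨z, ⟨hz1, hz2⟩, j, rfl⟩ := mem_closure_iff.1 hy (U ∩ v y k) (hU.inter (hv1 y k))
    ⟨hyU, hv2 y k⟩
  have : j ∈ {j | f j ∈ v x k} := by rw [hk]; exact hz2
  exact ⟨f j, hz1, this⟩

theorem exists_piece {X : Type u} (c : Cardinal.{u}) (S : Set X) :
    ∃ E : Set X, E ⊆ S ∧ #↥E ≤ c ∧ (#↥E < c → E = S) := by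
  rcases le_total #↥S c with h | h
  · exact ⟨S, subset_rfl, h, fun _ => rfl⟩
  · obtain ⟨E, hE, hc⟩ := Cardinal.le_mk_iff_exists_subset.1 h
    exact ⟨E, hE, hc.le, fun h => absurd hc h.ne⟩

/-- Theorem 4.4: if ψ_c(X) ≤ κ and saL_κ(X,2^κ) ≤ κ, then |X| ≤ 2^κ. -/
theorem card_le_two_pow_of_saLk {X : Type u} [TopologicalSpace X] [T2Space X]
    (κ : Cardinal.{u}) (hκ : ℵ₀ ≤ κ) (hpsic : psic X ≤ κ) (hsaL : saLk X κ (2 ^ κ) ≤ κ) :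
    #X ≤ 2 ^ κ := by
  let K : Type u := κ.out
  have hK : #K = κ := Cardinal.mk_out κ
  have h1 : ℵ₀ ≤ (2 : Cardinal.{u}) ^ κ := hκ.trans (Cardinal.cantor κ).le
  rcases isEmpty_or_nonempty X with hX | ⟨⟨x0⟩⟩
  · rw [Cardinal.mk_eq_zero]
    exact zero_le
  obtain ⟨v, hv1, hv2, hv3⟩ := exists_psic_fun (X := X) κ hκ hK hpsic
  choose E hE1 hE2 hE3 using fun S : Set X => exists_piece (2 ^ κ) S
  obtain ⟨A, hx0, hAc, hA⟩ := closing_off κ hκ hK x0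
    (fun f : K → X => closure (Set.range f) ∪
      ⋃ h : K → K, E (⋃ k, closure (v (f k) (h k)))ᶜ) (by
    intro f
    refine (Cardinal.mk_union_le _ _).trans ?_
    refine Cardinal.add_le_of_le h1 (mk_closure_range_le κ hκ hK v hv1 hv2 hv3 f) ?_
    refine (Cardinal.mk_iUnion_le_sum_mk).trans ?_
    refine (Cardinal.sum_le_sum _ (fun _ => 2 ^ κ) fun h => hE2 _).trans ?_
    rw [Cardinal.sum_const', ← Cardinal.power_def, hK, Cardinal.power_self_eq hκ,
      Cardinal.mul_eq_self h1])
  have hclk : clk κ A = A := by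
    apply Set.Subset.antisymm
    · intro x hx
      simp only [clk, Set.mem_iUnion, Set.mem_setOf_eq] at hx
      obtain ⟨B, ⟨hB, hBc⟩, hxB⟩ := hx
      obtain ⟨f, hf, hr⟩ := exists_enum (K := K) A x0 hx0 B hB (by rw [hK]; exact hBc)
      exact hA f hf (Or.inl (closure_mono hr hxB))
    · intro x hx
      simp only [clk, Set.mem_iUnion, Set.mem_setOf_eq]
      refine ⟨{x}, ⟨Set.singleton_subset_iff.2 hx, ?_⟩, subset_closure rfl⟩
      rw [Cardinal.mk_singleton]
      exact Cardinal.one_le_aleph0.trans hκ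
  suffices hu : A = Set.univ by
    rw [hu, Cardinal.mk_univ] at hAc
    exact hAc
  by_contra hu
  obtain ⟨y, hy⟩ := (Set.ne_univ_iff_exists_notMem A).1 hu
  have hc : ∀ x : X, ∃ k : K, x ∈ A → y ∉ closure (v x k) := by
    intro x
    by_contra! hcon
    obtain ⟨k0⟩ : Nonempty K := Cardinal.mk_ne_zero_iff.1
      (by rw [hK]; exact (Cardinal.aleph0_pos.trans_le hκ).ne')
    have := hv3 x y fun k => (hcon k).2
    exact hy (this ▸ (hcon k0).1)
  choose c hc using hc
  obtain ⟨𝒱, h2, h3, h4⟩ := saLk_apply κ hsaL A hclk ((fun x => v x (c x)) '' A)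
    (by rintro _ ⟨x, -, rfl⟩; exact hv1 _ _)
    (fun x hx => ⟨_, ⟨x, hx, rfl⟩, hv2 _ _⟩)
  choose p hp1 hp2 using fun V : 𝒱 => h2 V.2
  obtain ⟨f, hf, hr⟩ := exists_enum (K := K) A x0 hx0 (Set.range p)
    (by rintro _ ⟨V, rfl⟩; exact hp1 V) (by rw [hK]; exact Cardinal.mk_range_le.trans h3)
  have hsub : E (⋃ k, closure (v (f k) (c (f k))))ᶜ ⊆ A := fun x hx =>
    hA f hf (Or.inr (Set.mem_iUnion.2 ⟨fun k => c (f k), hx⟩))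
  have hlt : #↥(E (⋃ k, closure (v (f k) (c (f k))))ᶜ) < 2 ^ κ := by
    refine (Cardinal.mk_le_mk_of_subset ?_).trans_lt h4
    intro x hx
    refine ⟨hsub hx, fun hxV => hE1 _ hx ?_⟩
    simp only [Set.mem_iUnion] at hxV ⊢
    obtain ⟨V, hV, hxV⟩ := hxV
    obtain ⟨k, hk⟩ := hr ⟨⟨V, hV⟩, rfl⟩
    refine ⟨k, ?_⟩
    rw [hk]
    have h5 : v (p ⟨V, hV⟩) (c (p ⟨V, hV⟩)) = V := hp2 ⟨V, hV⟩
    rw [h5]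
    exact hxV
  rw [hE3 _ hlt] at hsub
  refine hy (hsub ?_)
  simp only [Set.mem_compl_iff, Set.mem_iUnion, not_exists]
  exact fun k => hc _ (hf k)
end
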